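/- Let λ ∈ F_{q^n} be such that F_q(λ) = F_{q^n}, and let S = ⟨1, λ, …, λ^{k−1}⟩_{F_q} with 1 < k < n − 1. (a) If k ≤ n/2, then for every μ ∈ F_{q^n}^* and every j ∈ {1,…,k}: dim_{F_q}(S ∩ μS) = j if and only if μ = p(λ)/q(λ) for some coprime polynomials p(x), q(x) ∈ F_q[x] of degree at most k−1 with max{deg p, deg q} = k − j; and in that case S ∩ μS = {p(λ)a(λ) : a(x) ∈ F_q[x], deg a ≤ j−1} = μ·{q(λ)a(λ) : a(x) ∈ F_q[x], deg a ≤ j−1}. (b) If n/2 < k < n−1, then for every μ ∈ F_{q^n}^* and every i ∈ {2k+1−n, …, k}: dim_{F_q}(S ∩ μS) = i if and only if μ = p(λ)/q(λ) for some coprime polynomials p(x), q(x) ∈ F_q[x] of degree at most k−1 with max{deg p, deg q} = k − i. -/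

import Mathlib

/-!
Setting: `q` is a prime power, realized by a finite field `Fq` with `Fintype.card Fq = q`;
`F` plays the role of `F_{q^n}`: a finite field extension of `Fq` with `Module.finrank Fq F = n`.
`F_q`-subspaces of `F_{q^n}` are `Submodule Fq F`; for a divisor `t` of `n`, the subfield
`F_{q^t}` is the (unique) `T : IntermediateField Fq F` with `Module.finrank Fq ↥T = t`, and
`F_{q^t}`-subspaces are `Submodule ↥T F`.
-/

set_option synthInstance.maxHeartbeats 1000000

namespace FWS

variable (R : Type*) {F : Type*} [Field R] [Field F] [Algebra R F]

/-- The cyclic shift `α S = {α * s : s ∈ S}` of an `R`-subspace `S` of `F`. -/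
def shift (α : F) (S : Submodule R F) : Submodule R F :=
  S.map (LinearMap.mulLeft R α)

/-- The subspace distance `d(U,V) = dim U + dim V - 2 dim (U ⊓ V)`
(which is `2k - 2 dim (U ⊓ V)` for `U, V` of the same dimension `k`). -/
noncomputable def sdist (U V : Submodule R F) : ℕ :=
  Module.finrank R ↥U + Module.finrank R ↥V - 2 * Module.finrank R ↥(U ⊓ V)

/-- The one-orbit cyclic subspace code `Orb(S) = {α S : α ∈ F*}`. -/
def orb (S : Submodule R F) : Set (Submodule R F) :=
  {T | ∃ α : F, α ≠ 0 ∧ T = shift R α S}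

/-- The weight `ω_{2i}(Orb(S)) = #{α S : α ∈ F*, d(S, α S) = 2 i}`. -/
noncomputable def omega (S : Submodule R F) (i : ℕ) : ℕ :=
  Nat.card {T : Submodule R F // T ∈ orb R S ∧ sdist R S T = 2 * i}

/-- `Orb(S)` is a full weight spectrum (FWS) code: `ω_{2i} > 0` for all `1 ≤ i ≤ dim S`. -/
def IsFWS (S : Submodule R F) : Prop :=
  ∀ i : ℕ, 1 ≤ i → i ≤ Module.finrank R ↥S → 0 < omega R S i

/-- The subspace `⟨1, l, ..., l^(k-1)⟩_R` spanned by the first `k` powers of `l`. -/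
def polySpan (l : F) (k : ℕ) : Submodule R F :=
  Submodule.span R ((fun i : ℕ => l ^ i) '' Set.Iio k)

/-- The invariant `m(Orb(S))`: the least divisor `t` of `n` such that
`dim_{F_{q^t}} ⟨S⟩_{F_{q^t}} = 1` (equivalently, the degree of the smallest subfield
containing a cyclic shift of `S`). -/
noncomputable def mOrb (S : Submodule R F) : ℕ :=
  sInf {t : ℕ | t ∣ Module.finrank R F ∧
    ∃ T : IntermediateField R F, Module.finrank R ↥T = t ∧
      Module.finrank ↥T ↥(Submodule.span ↥T (S : Set F)) = 1}

/-- The stabilizer `H(S) = {x ∈ F* : x S = S} ∪ {0}` of a set `S ⊆ F`, as a subset of `F`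
(it is a subfield of `F` when `S` is a subspace). -/
def stab {F : Type*} [Field F] (S : Set F) : Set F :=
  {x : F | x ≠ 0 ∧ (fun y => x * y) '' S = S} ∪ {0}

end FWS

open FWS

namespace FWS

open Polynomial

section

variable {R F : Type*} [Field R] [Field F] [Algebra R F]

lemma polySpan_eq_map (l : F) (k : ℕ) :
    polySpan R l k = (degreeLT R k).map (aeval l).toLinearMap := by
  classical
  rw [degreeLT_eq_span_X_pow, Submodule.map_span, polySpan]
  congr 1
  ext x
  simp

lemma mem_degreeLT_iff_natDegree_lt {k : ℕ} (hk : 0 < k) {f : R[X]} :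
    f ∈ degreeLT R k ↔ f.natDegree < k := by
  rw [mem_degreeLT]
  rcases eq_or_ne f 0 with rfl | hf
  · simp [hk]
  · exact (natDegree_lt_iff_degree_lt hf).symm

lemma mem_polySpan (l : F) {k : ℕ} (hk : 0 < k) (x : F) :
    x ∈ polySpan R l k ↔ ∃ f : R[X], f.natDegree < k ∧ aeval l f = x := by
  simp only [polySpan_eq_map, Submodule.mem_map, mem_degreeLT_iff_natDegree_lt hk,
    AlgHom.toLinearMap_apply]

lemma polySpan_zero (l : F) : polySpan R l 0 = ⊥ := by
  simp [polySpan]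

lemma polySpan_mono (l : F) {k m : ℕ} (h : k ≤ m) : polySpan R l k ≤ polySpan R l m :=
  Submodule.span_mono (Set.image_mono (Set.Iio_subset_Iio h))

lemma mem_shift {α x : F} {S : Submodule R F} : x ∈ shift R α S ↔ ∃ y ∈ S, α * y = x := by
  simp [shift]

lemma finrank_shift {α : F} (hα : α ≠ 0) (S : Submodule R F) :
    Module.finrank R (shift R α S) = Module.finrank R S :=
  (LinearEquiv.finrank_eq (Submodule.equivMapOfInjective (LinearMap.mulLeft R α)
    (mul_right_injective₀ hα) S)).symm

lemma finrank_polySpan {l : F} {n : ℕ}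
    (hinj : ∀ f : R[X], f.natDegree < n → aeval l f = 0 → f = 0) {m : ℕ} (hm : m ≤ n) :
    Module.finrank R (polySpan R l m) = m := by
  rcases Nat.eq_zero_or_pos m with rfl | hm0
  · rw [polySpan_zero, finrank_bot]
  have hi : Function.Injective ((aeval l).toLinearMap.domRestrict (degreeLT R m)) := by
    rw [← LinearMap.ker_eq_bot, LinearMap.ker_eq_bot']
    rintro ⟨f, hf⟩ h
    rw [mem_degreeLT_iff_natDegree_lt hm0] at hf
    exact Subtype.ext (hinj f (hf.trans_le hm) h)
  have h := LinearMap.finrank_range_of_inj hi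
  rw [LinearMap.range_domRestrict, ← polySpan_eq_map] at h
  rw [h, LinearEquiv.finrank_eq (degreeLTEquiv R m), Module.finrank_fin_fun]

/-- The intersection of `⟨1, l, …, l^(k-1)⟩` with its shift by a fraction of small height. -/
lemma polySpan_inf_shift_div {l : F} {n : ℕ}
    (hinj : ∀ f : R[X], f.natDegree < n → aeval l f = 0 → f = 0) {k d : ℕ}
    {p p' : R[X]} (hcop : IsCoprime p p') (hmax : max p.natDegree p'.natDegree = d)
    (hdk : d < k) (hkn : k + d ≤ n) (hp : aeval l p ≠ 0) (hp' : aeval l p' ≠ 0) :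
    polySpan R l k ⊓ shift R (aeval l p / aeval l p') (polySpan R l k) =
      shift R (aeval l p) (polySpan R l (k - d)) := by
  have hk : 0 < k := by lia
  have hkd : 0 < k - d := by lia
  have hp0 : p ≠ 0 := by rintro rfl; simp at hp
  have hp0' : p' ≠ 0 := by rintro rfl; simp at hp'
  have hpd : p.natDegree ≤ d := hmax ▸ le_max_left _ _
  have hpd' : p'.natDegree ≤ d := hmax ▸ le_max_right _ _
  ext x
  simp only [Submodule.mem_inf, mem_shift, mem_polySpan l hk, mem_polySpan l hkd]
  constructor
  · rintro ⟨⟨f, hf, hfx⟩, y, ⟨g, hg, rfl⟩, hgx⟩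
    have hev : aeval l (f * p' - p * g) = 0 := by
      rw [map_sub, map_mul, map_mul, hfx, ← hgx]
      field_simp
      ring
    have hdeg : (f * p' - p * g).natDegree < n := by
      have h1 := natDegree_sub_le (f * p') (p * g)
      have h2 := natDegree_mul_le (p := f) (q := p')
      have h3 := natDegree_mul_le (p := p) (q := g)
      lia
    have heq : f * p' = p * g := sub_eq_zero.mp (hinj _ hdeg hev)
    obtain ⟨a, rfl⟩ : p ∣ f := hcop.dvd_of_dvd_mul_right ⟨g, heq⟩
    have hga : g = a * p' := by
      apply mul_left_cancel₀ hp0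
      rw [← heq, mul_assoc]
    refine ⟨aeval l a, ⟨a, ?_, rfl⟩, by rw [← hfx, map_mul]⟩
    rcases eq_or_ne a 0 with rfl | ha
    · simpa using hdk
    · rw [natDegree_mul hp0 ha] at hf
      rw [hga, natDegree_mul ha hp0'] at hg
      rcases max_choice p.natDegree p'.natDegree with h | h <;> lia
  · rintro ⟨y, ⟨a, ha, rfl⟩, rfl⟩
    refine ⟨⟨p * a, ?_, map_mul _ _ _⟩, aeval l (p' * a), ⟨p' * a, ?_, rfl⟩, ?_⟩
    · have := natDegree_mul_le (p := p) (q := a)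
      lia
    · have := natDegree_mul_le (p := p') (q := a)
      lia
    · rw [map_mul]
      field_simp

lemma finrank_polySpan_inf_shift_div {l : F} {n : ℕ}
    (hinj : ∀ f : R[X], f.natDegree < n → aeval l f = 0 → f = 0) {k d : ℕ}
    {p p' : R[X]} (hcop : IsCoprime p p') (hmax : max p.natDegree p'.natDegree = d)
    (hdk : d < k) (hkn : k + d ≤ n) (hp : aeval l p ≠ 0) (hp' : aeval l p' ≠ 0) :
    Module.finrank R
      ↥(polySpan R l k ⊓ shift R (aeval l p / aeval l p') (polySpan R l k)) = k - d := by
  rw [polySpan_inf_shift_div hinj hcop hmax hdk hkn hp hp', finrank_shift hp,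
    finrank_polySpan hinj (by lia)]

/-- If `⟨1, l, …, l^(m-1)⟩` meets its shift by `μ`, then `μ` is a fraction in `l` whose numerator
and denominator are coprime of degree less than `m`. -/
lemma exists_coprime_of_inf_shift_ne_bot {l μ : F} {m : ℕ}
    (h : polySpan R l m ⊓ shift R μ (polySpan R l m) ≠ ⊥) :
    ∃ p p' : R[X], IsCoprime p p' ∧ max p.natDegree p'.natDegree < m ∧
      aeval l p ≠ 0 ∧ aeval l p' ≠ 0 ∧ μ = aeval l p / aeval l p' := by
  classical
  have hm : 0 < m := by
    rw [Nat.pos_iff_ne_zero]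
    rintro rfl
    simp [polySpan_zero] at h
  obtain ⟨x, hx, hx0⟩ := Submodule.exists_mem_ne_zero_of_ne_bot h
  simp only [Submodule.mem_inf, mem_shift, mem_polySpan l hm] at hx
  obtain ⟨⟨f, hf, hfx⟩, y, ⟨g, hg, rfl⟩, hgx⟩ := hx
  have hf0 : f ≠ 0 := by rintro rfl; simp at hfx; exact hx0 hfx.symm
  have hgl : aeval l g ≠ 0 := by rintro h; rw [h, mul_zero] at hgx; exact hx0 hgx.symm
  have hg0 : g ≠ 0 := by rintro rfl; simp at hgl
  have hc0 : gcd f g ≠ 0 := gcd_ne_zero_of_left hf0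
  have hcop := isCoprime_div_gcd_div_gcd (p := f) hg0
  have hfp := EuclideanDomain.mul_div_cancel' hc0 (gcd_dvd_left f g)
  have hgp := EuclideanDomain.mul_div_cancel' hc0 (gcd_dvd_right f g)
  generalize gcd f g = c at hc0 hcop hfp hgp
  generalize f / c = p at hcop hfp
  generalize g / c = p' at hcop hgp
  subst hfp hgp
  have hp0 : p ≠ 0 := right_ne_zero_of_mul hf0
  have hp0' : p' ≠ 0 := right_ne_zero_of_mul hg0
  rw [natDegree_mul hc0 hp0] at hf
  rw [natDegree_mul hc0 hp0'] at hg
  rw [map_mul] at hfx hgl hgx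
  rw [← hfx] at hx0
  have hcl := left_ne_zero_of_mul hgl
  have hpl' := right_ne_zero_of_mul hgl
  refine ⟨p, p', hcop, by lia, right_ne_zero_of_mul hx0, hpl', ?_⟩
  rw [eq_div_iff hpl']
  apply mul_left_cancel₀ hcl
  rw [hfx, ← hgx]
  ring

lemma finrank_inf_shift_add_sup [FiniteDimensional R F] {l μ : F} {n : ℕ} (hμ : μ ≠ 0)
    (hinj : ∀ f : R[X], f.natDegree < n → aeval l f = 0 → f = 0) {m : ℕ} (hm : m ≤ n) :
    Module.finrank R ↥(polySpan R l m ⊔ shift R μ (polySpan R l m)) +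
      Module.finrank R ↥(polySpan R l m ⊓ shift R μ (polySpan R l m)) = 2 * m := by
  rw [Submodule.finrank_sup_add_finrank_inf_eq, finrank_shift hμ, finrank_polySpan hinj hm,
    two_mul]

lemma exists_coprime_of_finrank_inf_shift [FiniteDimensional R F] {l μ : F} {n : ℕ} (hμ : μ ≠ 0)
    (hn : Module.finrank R F = n)
    (hinj : ∀ f : R[X], f.natDegree < n → aeval l f = 0 → f = 0) {k j : ℕ} (hkn : k < n)
    (hj : 1 ≤ j) (hjk : 2 * k + 1 ≤ n + j)
    (h : Module.finrank R ↥(polySpan R l k ⊓ shift R μ (polySpan R l k)) = j) :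
    ∃ p p' : R[X], IsCoprime p p' ∧ max p.natDegree p'.natDegree = k - j ∧
      μ = aeval l p / aeval l p' := by
  have hex : ∃ m, polySpan R l m ⊓ shift R μ (polySpan R l m) ≠ ⊥ :=
    ⟨k, fun h0 => by rw [h0, finrank_bot] at h; lia⟩
  have hmk : Nat.find hex ≤ k :=
    Nat.find_min' hex fun h0 => by rw [h0, finrank_bot] at h; lia
  obtain ⟨p, p', hcop, hlt, hp, hp', rfl⟩ :=
    exists_coprime_of_inf_shift_ne_bot (Nat.find_spec hex)
  obtain ⟨d, hd⟩ : ∃ d, max p.natDegree p'.natDegree = d := ⟨_, rfl⟩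
  rw [hd] at hlt
  refine ⟨p, p', hcop, ?_, rfl⟩
  have hbot := not_not.mp (Nat.find_min hex hlt)
  have hdn := finrank_inf_shift_add_sup hμ hinj (m := d) (by lia)
  rw [hbot, finrank_bot] at hdn
  have hle := hn ▸ Submodule.finrank_le
    (polySpan R l d ⊔ shift R (aeval l p / aeval l p') (polySpan R l d))
  by_cases hkd : k + d ≤ n
  · rw [finrank_polySpan_inf_shift_div hinj hcop hd (by lia) hkd hp hp'] at h
    lia
  · exfalso
    have hsmall : Module.finrank R ↥(polySpan R l (n - d) ⊓
        shift R (aeval l p / aeval l p') (polySpan R l (n - d))) = n - d - d := by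
      rcases Nat.lt_or_ge d (n - d) with hlt' | hge
      · exact finrank_polySpan_inf_shift_div hinj hcop hd hlt' (by lia) hp hp'
      · have : n - d = d := by lia
        rw [this, hbot, finrank_bot, Nat.sub_self]
    have h1 := finrank_inf_shift_add_sup hμ hinj (m := n - d) (by lia)
    have h2 := finrank_inf_shift_add_sup hμ hinj hkn.le
    have hmono := polySpan_mono (R := R) l (show n - d ≤ k by lia)
    have h3 := Submodule.finrank_mono (sup_le_sup hmono
      (Submodule.map_mono (f := LinearMap.mulLeft R (aeval l p / aeval l p')) hmono))
    change Module.finrank R ↥(polySpan R l (n - d) ⊔ shift R _ (polySpan R l (n - d))) ≤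
      Module.finrank R ↥(polySpan R l k ⊔ shift R _ (polySpan R l k)) at h3
    lia

lemma eq_zero_of_natDegree_lt_of_aeval_eq_zero [FiniteDimensional R F] {l : F}
    (hl : IntermediateField.adjoin R {l} = ⊤) (f : R[X])
    (hf : f.natDegree < Module.finrank R F) (h : aeval l f = 0) : f = 0 := by
  by_contra h0
  have h1 := IntermediateField.adjoin.finrank (IsIntegral.of_finite R l)
  rw [hl, IntermediateField.finrank_top'] at h1
  have h2 := natDegree_le_natDegree (minpoly.degree_le_of_ne_zero R l h0 h)
  lia

end

end FWS

/-- Lemma 4.3: intersections of `S = ⟨1, λ, …, λ^(k-1)⟩_{F_q}` with its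
cyclic shifts, for `λ` generating `F_{q^n}` over `F_q`, in terms of pairs of coprime
polynomials. -/
theorem polySpan_shift_intersections
    {Fq F : Type*} [Field Fq] [Field F] [Algebra Fq F] [Fintype Fq] [Fintype F]
    (q n : ℕ) (hq : Fintype.card Fq = q) (hn : Module.finrank Fq F = n)
    (lam : F) (hlam : IntermediateField.adjoin Fq {lam} = ⊤)
    (k : ℕ) (hk1 : 1 < k) (hk2 : k < n - 1) (S : Submodule Fq F)
    (hS : S = polySpan Fq lam k) :
    -- (a) the case `k ≤ n/2`
    (2 * k ≤ n → ∀ μ : F, μ ≠ 0 → ∀ j : ℕ, 1 ≤ j → j ≤ k →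
      ((Module.finrank Fq ↥(S ⊓ shift Fq μ S) = j ↔
        ∃ p p' : Polynomial Fq, IsCoprime p p' ∧
          p.natDegree ≤ k - 1 ∧ p'.natDegree ≤ k - 1 ∧
          max p.natDegree p'.natDegree = k - j ∧
          μ = Polynomial.aeval lam p / Polynomial.aeval lam p') ∧
       -- in particular, for such a pair of polynomials,
       -- `S ∩ μS = {p(λ)a(λ) : deg a ≤ j-1} = μ {p'(λ)a(λ) : deg a ≤ j-1}`
       (∀ p p' : Polynomial Fq, IsCoprime p p' →
          p.natDegree ≤ k - 1 → p'.natDegree ≤ k - 1 →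
          max p.natDegree p'.natDegree = k - j →
          μ = Polynomial.aeval lam p / Polynomial.aeval lam p' →
          ((S ⊓ shift Fq μ S : Submodule Fq F) : Set F) =
              {x : F | ∃ a : Polynomial Fq, a.natDegree ≤ j - 1 ∧
                x = Polynomial.aeval lam p * Polynomial.aeval lam a} ∧
          ((S ⊓ shift Fq μ S : Submodule Fq F) : Set F) =
              (fun y => μ * y) '' {x : F | ∃ a : Polynomial Fq, a.natDegree ≤ j - 1 ∧
                x = Polynomial.aeval lam p' * Polynomial.aeval lam a}))) ∧
    -- (b) the case `n/2 < k < n - 1`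
    (n < 2 * k → ∀ μ : F, μ ≠ 0 → ∀ i : ℕ, 2 * k + 1 - n ≤ i → i ≤ k →
      (Module.finrank Fq ↥(S ⊓ shift Fq μ S) = i ↔
        ∃ p p' : Polynomial Fq, IsCoprime p p' ∧
          p.natDegree ≤ k - 1 ∧ p'.natDegree ≤ k - 1 ∧
          max p.natDegree p'.natDegree = k - i ∧
          μ = Polynomial.aeval lam p / Polynomial.aeval lam p')) := by
  have : FiniteDimensional Fq F := Module.Finite.of_finite
  subst hS hn
  have hinj := eq_zero_of_natDegree_lt_of_aeval_eq_zero hlam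
  have key : ∀ μ : F, μ ≠ 0 → ∀ j : ℕ, 1 ≤ j → j ≤ k →
      2 * k + 1 ≤ Module.finrank Fq F + j →
      (Module.finrank Fq ↥(polySpan Fq lam k ⊓ shift Fq μ (polySpan Fq lam k)) = j ↔
        ∃ p p' : Polynomial Fq, IsCoprime p p' ∧
          p.natDegree ≤ k - 1 ∧ p'.natDegree ≤ k - 1 ∧
          max p.natDegree p'.natDegree = k - j ∧
          μ = Polynomial.aeval lam p / Polynomial.aeval lam p') := by
    intro μ hμ j hj hjk hjn
    constructor
    · intro h
      obtain ⟨p, p', hcop, hmax, hpp⟩ :=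
        exists_coprime_of_finrank_inf_shift hμ rfl hinj (by lia) hj hjn h
      exact ⟨p, p', hcop, by lia, by lia, hmax, hpp⟩
    · rintro ⟨p, p', hcop, -, -, hmax, rfl⟩
      obtain ⟨hp, hp'⟩ := div_ne_zero_iff.mp hμ
      rw [finrank_polySpan_inf_shift_div hinj hcop hmax (by lia) (by lia) hp hp']
      lia
  refine ⟨fun hkn μ hμ j hj hjk => ⟨key μ hμ j hj hjk (by lia), ?_⟩,
    fun hkn μ hμ i hi hik => key μ hμ i (by lia) hik (by lia)⟩
  rintro p p' hcop - - hmax rfl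
  obtain ⟨hp, hp'⟩ := div_ne_zero_iff.mp hμ
  have hset : ((polySpan Fq lam k ⊓ shift Fq (Polynomial.aeval lam p / Polynomial.aeval lam p')
      (polySpan Fq lam k) : Submodule Fq F) : Set F) =
      {x : F | ∃ a : Polynomial Fq, a.natDegree ≤ j - 1 ∧
        x = Polynomial.aeval lam p * Polynomial.aeval lam a} := by
    rw [polySpan_inf_shift_div hinj hcop hmax (by lia) (by lia) hp hp']
    ext x
    rw [SetLike.mem_coe, mem_shift, Set.mem_ofPred_eq]
    simp only [mem_polySpan lam (show 0 < k - (k - j) by lia)]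
    constructor
    · rintro ⟨y, ⟨a, ha, rfl⟩, rfl⟩
      exact ⟨a, by lia, rfl⟩
    · rintro ⟨a, ha, rfl⟩
      exact ⟨_, ⟨a, by lia, rfl⟩, rfl⟩
  refine ⟨hset, ?_⟩
  rw [hset]
  ext x
  constructor
  · rintro ⟨a, ha, rfl⟩
    refine ⟨_, ⟨a, ha, rfl⟩, ?_⟩
    field_simp
  · rintro ⟨y, ⟨a, ha, rfl⟩, rfl⟩
    refine ⟨a, ha, ?_⟩
    field_simp
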